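/- arXiv:2001.00799 — 3 statements merged into one kernel-verified Lean document; each statement's English description precedes it below -/
import Mathlib

section
/- If ρ_{AB} = |g_j⟩⟨g_j| ⊗ ρ_B, where |g_j⟩ is an eigenvector of G (so the marginal on A is a pure eigenstate of G), then the bipartite uncertainty bound is saturated: S(R|AB)_κ + S(A|B)_ω = S(R)_κ + D(κ_A ‖ ω_A) + S(A|B)_ρ. -/
open scoped Kronecker Classical ComplexOrder
open Matrix

noncomputable section

/-- The rank-one projector `|v⟩⟨v|`. -/
def proj {α : Type*} (v : α → ℂ) : Matrix α α ℂ := Matrix.vecMulVec v (star v)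

/-- Matrix logarithm of a Hermitian matrix, via the spectral decomposition
(junk value `0` on non-Hermitian matrices; eigenvalue `0` contributes `log 0 = 0`). -/
def mlog {n : Type*} [Fintype n] [DecidableEq n] (ρ : Matrix n n ℂ) : Matrix n n ℂ :=
  if h : ρ.IsHermitian then
    (h.eigenvectorUnitary : Matrix n n ℂ) *
      Matrix.diagonal (fun i => (Real.log (h.eigenvalues i) : ℂ)) *
      (h.eigenvectorUnitary : Matrix n n ℂ)ᴴ
  else 0

/-- Von Neumann entropy `S(ρ) = -Tr ρ log ρ`. -/
def vN {n : Type*} [Fintype n] [DecidableEq n] (ρ : Matrix n n ℂ) : ℝ :=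
  -(Matrix.trace (ρ * mlog ρ)).re

/-- Quantum relative entropy `D(ρ‖σ) = Tr ρ (log ρ - log σ)`. -/
def relent {n : Type*} [Fintype n] [DecidableEq n] (ρ σ : Matrix n n ℂ) : ℝ :=
  (Matrix.trace (ρ * (mlog ρ - mlog σ))).re

/-- The rotation `e^{-iGr}` generated by the Hermitian operator `G` with orthonormal
eigenbasis `g` and eigenvalues `gv`. -/
def Urot {iA : Type*} [Fintype iA] (g : iA → iA → ℂ) (gv : iA → ℝ) (r : ℝ) : Matrix iA iA ℂ :=
  ∑ l, Complex.exp (-(Complex.I) * (gv l) * r) • proj (g l)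

section Bipartite

variable {iR iA iB : Type*} [Fintype iR] [Fintype iA] [Fintype iB]
  [DecidableEq iR] [DecidableEq iA] [DecidableEq iB]

/-- `κ_{RAB} = Σ_k p_k |r_k⟩⟨r_k| ⊗ (e^{-iGr_k}⊗I) ρ (e^{iGr_k}⊗I)`. -/
def kappa2 (p : iR → ℝ) (rb : iR → iR → ℂ) (rv : iR → ℝ) (g : iA → iA → ℂ) (gv : iA → ℝ)
    (ρ : Matrix (iA × iB) (iA × iB) ℂ) :
    Matrix (iR × (iA × iB)) (iR × (iA × iB)) ℂ :=
  ∑ k, (p k : ℂ) •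
    (proj (rb k) ⊗ₖ
      ((Urot g gv (rv k) ⊗ₖ (1 : Matrix iB iB ℂ)) * ρ *
        (Urot g gv (rv k) ⊗ₖ (1 : Matrix iB iB ℂ))ᴴ))

/-- `ω_{AB} = Σ_l (|g_l⟩⟨g_l|⊗I) ρ (|g_l⟩⟨g_l|⊗I)`. -/
def omega2 (g : iA → iA → ℂ) (ρ : Matrix (iA × iB) (iA × iB) ℂ) :
    Matrix (iA × iB) (iA × iB) ℂ :=
  ∑ l, ((proj (g l) ⊗ₖ (1 : Matrix iB iB ℂ)) * ρ * (proj (g l) ⊗ₖ (1 : Matrix iB iB ℂ)))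

/-- Reduced state on `AB` of a state on `RAB`. -/
def redABthree (τ : Matrix (iR × (iA × iB)) (iR × (iA × iB)) ℂ) :
    Matrix (iA × iB) (iA × iB) ℂ :=
  Matrix.of fun x y => ∑ k : iR, τ (k, x) (k, y)

/-- Reduced state on `R` of a state on `RAB`. -/
def redRthree (τ : Matrix (iR × (iA × iB)) (iR × (iA × iB)) ℂ) :
    Matrix iR iR ℂ :=
  Matrix.of fun i j => ∑ x : iA × iB, τ (i, x) (j, x)

/-- Reduced state on `A` of a state on `RAB`. -/
def redAthree (τ : Matrix (iR × (iA × iB)) (iR × (iA × iB)) ℂ) :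
    Matrix iA iA ℂ :=
  Matrix.of fun i j => ∑ k : iR, ∑ b : iB, τ (k, (i, b)) (k, (j, b))

/-- Reduced state on `A` of a state on `AB`. -/
def redA2 (σ : Matrix (iA × iB) (iA × iB) ℂ) : Matrix iA iA ℂ :=
  Matrix.of fun i j => ∑ b : iB, σ (i, b) (j, b)

/-- Reduced state on `B` of a state on `AB`. -/
def redB2' (σ : Matrix (iA × iB) (iA × iB) ℂ) : Matrix iB iB ℂ :=
  Matrix.of fun i j => ∑ a : iA, σ (a, i) (a, j)

end Bipartite

theorem spec_form {n : Type*} [Fintype n] [DecidableEq n] {ρ : Matrix n n ℂ}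
    (h : ρ.IsHermitian) :
    ρ = (h.eigenvectorUnitary : Matrix n n ℂ) *
      Matrix.diagonal (fun i => (h.eigenvalues i : ℂ)) *
      (h.eigenvectorUnitary : Matrix n n ℂ)ᴴ := by
  have := h.spectral_theorem
  rw [Unitary.conjStarAlgAut_apply] at this
  exact this

theorem vN_eq_sum {n : Type*} [Fintype n] [DecidableEq n] {ρ : Matrix n n ℂ}
    (h : ρ.IsHermitian) : vN ρ = ∑ i, Real.negMulLog (h.eigenvalues i) := by
  have hU : (h.eigenvectorUnitary : Matrix n n ℂ)ᴴ * (h.eigenvectorUnitary : Matrix n n ℂ) = 1 :=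
    Unitary.coe_star_mul_self h.eigenvectorUnitary
  have key : (ρ * mlog ρ).trace = ∑ i, ((h.eigenvalues i * Real.log (h.eigenvalues i) : ℝ) : ℂ) := by
    unfold mlog
    rw [dif_pos h]
    generalize hL : (fun i => (Real.log (h.eigenvalues i) : ℂ)) = L
    have e := spec_form h
    generalize (h.eigenvectorUnitary : Matrix n n ℂ) = U at *
    generalize h.eigenvalues = d at *
    subst hL
    rw [e]
    have : (U * diagonal (fun i => (d i : ℂ)) * Uᴴ) *
        (U * diagonal (fun i => (Real.log (d i) : ℂ)) * Uᴴ)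
        = U * (diagonal (fun i => (d i : ℂ)) * diagonal (fun i => (Real.log (d i) : ℂ))) * Uᴴ := by
      calc _ = U * diagonal (fun i => (d i : ℂ)) * (Uᴴ * U) *
            diagonal (fun i => (Real.log (d i) : ℂ)) * Uᴴ := by simp only [Matrix.mul_assoc]
        _ = _ := by rw [hU]; simp only [Matrix.mul_assoc, Matrix.one_mul]
    rw [this, Matrix.trace_mul_comm, ← Matrix.mul_assoc, hU, Matrix.one_mul,
      Matrix.diagonal_mul_diagonal, Matrix.trace_diagonal]
    simp
  unfold vN
  rw [key, ← Complex.ofReal_sum, Complex.ofReal_re, ← Finset.sum_neg_distrib]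
  simp [Real.negMulLog]

theorem vN_of_form {n : Type*} [Fintype n] [DecidableEq n] {ρ U : Matrix n n ℂ} {d : n → ℝ}
    (hU : Uᴴ * U = 1) (e : ρ = U * Matrix.diagonal (fun i => (d i : ℂ)) * Uᴴ) :
    vN ρ = ∑ i, Real.negMulLog (d i) := by
  have h : ρ.IsHermitian := by
    unfold Matrix.IsHermitian
    rw [e]
    simp only [Matrix.conjTranspose_mul, Matrix.conjTranspose_conjTranspose,
      Matrix.diagonal_conjTranspose, Matrix.mul_assoc]
    congr 3
    ext i
    simp
  have hc : ρ.charpoly = (Matrix.diagonal (fun i => (d i : ℂ))).charpoly := by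
    rw [e, Matrix.mul_assoc, Matrix.charpoly_mul_comm, Matrix.mul_assoc, hU, Matrix.mul_one]
  have hr := h.roots_charpoly_eq_eigenvalues
  rw [hc, Matrix.charpoly_diagonal, Polynomial.roots_prod _ _ (by
    rw [Finset.prod_ne_zero_iff]; intro i _; exact Polynomial.X_sub_C_ne_zero _)] at hr
  simp only [Polynomial.roots_X_sub_C, Multiset.bind_singleton] at hr
  have hr2 := congrArg (fun m => (m.map (fun z : ℂ => Real.negMulLog z.re)).sum) hr
  simp only [Multiset.map_map] at hr2
  rw [vN_eq_sum h]
  exact hr2.symm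

theorem sum_eig {n : Type*} [Fintype n] [DecidableEq n] {ρ : Matrix n n ℂ}
    (h : ρ.IsHermitian) (ht : ρ.trace = 1) : ∑ i, h.eigenvalues i = 1 := by
  have := h.trace_eq_sum_eigenvalues
  rw [ht] at this
  have h2 := congrArg Complex.re this
  rw [Complex.re_sum] at h2
  exact h2.symm

theorem vN_kron {m n : Type*} [Fintype m] [DecidableEq m] [Fintype n] [DecidableEq n]
    {P : Matrix m m ℂ} {Q : Matrix n n ℂ} (hP : P.IsHermitian) (hQ : Q.IsHermitian)
    (tP : P.trace = 1) (tQ : Q.trace = 1) : vN (P ⊗ₖ Q) = vN P + vN Q := by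
  have hU : (hP.eigenvectorUnitary : Matrix m m ℂ)ᴴ * (hP.eigenvectorUnitary : Matrix m m ℂ) = 1 :=
    Unitary.coe_star_mul_self hP.eigenvectorUnitary
  have hV : (hQ.eigenvectorUnitary : Matrix n n ℂ)ᴴ * (hQ.eigenvectorUnitary : Matrix n n ℂ) = 1 :=
    Unitary.coe_star_mul_self hQ.eigenvectorUnitary
  have e : P ⊗ₖ Q = ((hP.eigenvectorUnitary : Matrix m m ℂ) ⊗ₖ (hQ.eigenvectorUnitary : Matrix n n ℂ))
      * Matrix.diagonal (fun i : m × n => ((hP.eigenvalues i.1 * hQ.eigenvalues i.2 : ℝ) : ℂ)) *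
      ((hP.eigenvectorUnitary : Matrix m m ℂ) ⊗ₖ (hQ.eigenvectorUnitary : Matrix n n ℂ))ᴴ := by
    conv_lhs => rw [spec_form hP, spec_form hQ]
    rw [Matrix.conjTranspose_kronecker, Matrix.mul_kronecker_mul, Matrix.mul_kronecker_mul,
      Matrix.diagonal_kronecker_diagonal]
    simp
  rw [vN_of_form (by rw [Matrix.conjTranspose_kronecker, ← Matrix.mul_kronecker_mul, hU, hV,
    Matrix.one_kronecker_one]) e, vN_eq_sum hP, vN_eq_sum hQ, Fintype.sum_prod_type]
  simp only [Real.negMulLog_mul, Finset.sum_add_distrib, ← Finset.mul_sum, ← Finset.sum_mul]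
  rw [sum_eig hP tP, sum_eig hQ tQ]
  ring

theorem proj_herm {α : Type*} (v : α → ℂ) : (proj v)ᴴ = proj v := by
  ext i k
  simp [proj, Matrix.vecMulVec_apply, mul_comm]

theorem proj_mul {α : Type*} [Fintype α] (v w : α → ℂ) :
    proj v * proj w = (star v ⬝ᵥ w) • Matrix.vecMulVec v (star w) := by
  simp [proj, Matrix.vecMulVec_mul_vecMulVec, Matrix.smul_vecMulVec]

theorem proj_mul_orth {α : Type*} [Fintype α] [DecidableEq α] {g : α → α → ℂ}
    (hg : ∀ l m, star (g l) ⬝ᵥ g m = if l = m then 1 else 0) (l m : α) :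
    proj (g l) * proj (g m) = if l = m then proj (g m) else 0 := by
  rw [proj_mul, hg]
  split_ifs with h
  · subst h; simp [proj]
  · simp

theorem proj_trace {α : Type*} [Fintype α] (v : α → ℂ) : (proj v).trace = star v ⬝ᵥ v := by
  simp [proj, Matrix.trace_vecMulVec, dotProduct_comm]

theorem Urot_conj {α : Type*} [Fintype α] [DecidableEq α] {g : α → α → ℂ} (gv : α → ℝ)
    (hg : ∀ l m, star (g l) ⬝ᵥ g m = if l = m then 1 else 0) (r : ℝ) (j : α) :
    Urot g gv r * proj (g j) * (Urot g gv r)ᴴ = proj (g j) := by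
  have h1 : Urot g gv r * proj (g j) = Complex.exp (-(Complex.I) * (gv j) * r) • proj (g j) := by
    simp [Urot, Finset.sum_mul, proj_mul_orth hg]
  have h2 : proj (g j) * (Urot g gv r)ᴴ
      = star (Complex.exp (-(Complex.I) * (gv j) * r)) • proj (g j) := by
    have := congrArg Matrix.conjTranspose h1
    rwa [Matrix.conjTranspose_mul, Matrix.conjTranspose_smul, proj_herm] at this
  rw [h1, Matrix.smul_mul, h2, smul_smul]
  have : Complex.exp (-(Complex.I) * (gv j) * r) * star (Complex.exp (-(Complex.I) * (gv j) * r))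
      = 1 := by
    rw [Complex.star_def, ← Complex.exp_conj, ← Complex.exp_add]
    simp
  rw [this, one_smul]

/-- **Saturation of the bipartite bound for a pure eigenstate of `G` on `A`**:
if `ρ_{AB} = |g_j⟩⟨g_j| ⊗ ρ_B`, then
`S(R|AB)_κ + S(A|B)_ω = S(R)_κ + D(κ_A‖ω_A) + S(A|B)_ρ`. -/
theorem bipartite_entropic_uncertainty_saturation_eigenstate
    {iR iA iB : Type*} [Fintype iR] [Fintype iA] [Fintype iB]
    [DecidableEq iR] [DecidableEq iA] [DecidableEq iB]
    (ρ : Matrix (iA × iB) (iA × iB) ℂ)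
    (hρ : ρ.PosSemidef) (hρtr : ρ.trace = 1)
    (g : iA → iA → ℂ) (gv : iA → ℝ)
    (hg : ∀ l m, star (g l) ⬝ᵥ g m = if l = m then 1 else 0)
    (hgc : ∑ l, proj (g l) = (1 : Matrix iA iA ℂ))
    (j : iA) (ρB : Matrix iB iB ℂ) (hρB : ρB.PosSemidef) (hρBtr : ρB.trace = 1)
    (heig : ρ = proj (g j) ⊗ₖ ρB)
    (rb : iR → iR → ℂ)
    (hrb : ∀ k m, star (rb k) ⬝ᵥ rb m = if k = m then 1 else 0)
    (hrbc : ∑ k, proj (rb k) = (1 : Matrix iR iR ℂ))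
    (rv : iR → ℝ) (p : iR → ℝ) (hp : ∀ k, 0 ≤ p k) (hps : ∑ k, p k = 1) :
    (vN (kappa2 p rb rv g gv ρ) - vN (redABthree (kappa2 p rb rv g gv ρ)))
      + (vN (omega2 g ρ) - vN (redB2' (omega2 g ρ)))
    = vN (redRthree (kappa2 p rb rv g gv ρ))
      + relent (redAthree (kappa2 p rb rv g gv ρ)) (redA2 (omega2 g ρ))
      + (vN ρ - vN (redB2' ρ)) := by
  set P : Matrix iR iR ℂ := ∑ k, (p k : ℂ) • proj (rb k) with hPdef
  have hPh : P.IsHermitian := by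
    unfold Matrix.IsHermitian
    simp [hPdef, Matrix.conjTranspose_sum, Matrix.conjTranspose_smul, proj_herm]
  have hPt : P.trace = 1 := by
    simp only [hPdef, Matrix.trace_sum, Matrix.trace_smul, proj_trace, hrb, if_true]
    simp only [smul_eq_mul, mul_one]
    exact_mod_cast hps
  have hκ : kappa2 p rb rv g gv ρ = P ⊗ₖ ρ := by
    have hU : ∀ k, (Urot g gv (rv k) ⊗ₖ (1 : Matrix iB iB ℂ)) * ρ *
        (Urot g gv (rv k) ⊗ₖ (1 : Matrix iB iB ℂ))ᴴ = ρ := by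
      intro k
      rw [heig, Matrix.conjTranspose_kronecker, ← Matrix.mul_kronecker_mul,
        ← Matrix.mul_kronecker_mul, Urot_conj gv hg]
      simp
    unfold kappa2
    simp only [hU]
    ext ⟨a, x⟩ ⟨b, y⟩
    simp [hPdef, Matrix.sum_apply, Matrix.kroneckerMap_apply, Finset.sum_mul, mul_assoc]
  have hω : omega2 g ρ = ρ := by
    unfold omega2
    have : ∀ l, (proj (g l) ⊗ₖ (1 : Matrix iB iB ℂ)) * ρ * (proj (g l) ⊗ₖ (1 : Matrix iB iB ℂ))
        = if l = j then ρ else 0 := by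
      intro l
      rw [heig, ← Matrix.mul_kronecker_mul, ← Matrix.mul_kronecker_mul, proj_mul_orth hg]
      split_ifs with h
      · subst h
        rw [proj_mul_orth hg]; simp
      · simp
    simp [this]
  have hPs : ∑ k, P k k = 1 := hPt
  have hAB : redABthree (P ⊗ₖ ρ) = ρ := by
    ext x y
    simp only [redABthree, Matrix.of_apply, Matrix.kroneckerMap_apply, ← Finset.sum_mul]
    rw [hPs, one_mul]
  have hρs : ∑ x, ρ x x = 1 := hρtr
  have hR : redRthree (P ⊗ₖ ρ) = P := by
    ext x y
    simp only [redRthree, Matrix.of_apply, Matrix.kroneckerMap_apply, ← Finset.mul_sum]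
    rw [hρs, mul_one]
  have hA : redAthree (P ⊗ₖ ρ) = redA2 ρ := by
    ext x y
    simp only [redAthree, redA2, Matrix.of_apply, Matrix.kroneckerMap_apply, ← Finset.mul_sum,
      ← Finset.sum_mul]
    rw [hPs, one_mul]
  rw [hκ, hω, hAB, hR, hA, vN_kron hPh hρ.isHermitian hPt hρtr]
  simp [relent]
end
end

section
/- Let P_G be the pinching map in the eigenbasis of G and V = Σ_k |g_k⟩_E ⊗ |g_k⟩⟨g_k|_A its Stinespring dilation isometry. Then for every density operator ρ on H_A, D(ρ ‖ P_G(ρ)) = −S(E|A)_{VρV†}, i.e. the relative entropy of ρ to its pinched version equals minus the conditional entropy of the environment E given A in the dilated state VρV†. -/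
open scoped Kronecker Classical ComplexOrder
open Matrix

noncomputable section

/-- The pinching map `P_G(ρ) = Σ_k |g_k⟩⟨g_k| ⟨g_k|ρ|g_k⟩` in the eigenbasis `g` of `G`. -/
def pinch {iA : Type*} [Fintype iA] (g : iA → iA → ℂ) (ρ : Matrix iA iA ℂ) :
    Matrix iA iA ℂ :=
  ∑ k, (star (g k) ⬝ᵥ ρ *ᵥ g k) • proj (g k)

/-- The Stinespring dilation isometry `V = Σ_k |g_k⟩_E ⊗ |g_k⟩⟨g_k|_A : H_A → H_E ⊗ H_A`,
where `H_E` is a copy of `H_A`. -/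
def Vdil {iA : Type*} [Fintype iA] (g : iA → iA → ℂ) : Matrix (iA × iA) iA ℂ :=
  Matrix.of fun p j => ∑ k, g k p.1 * (g k p.2 * star (g k j))

/-- Reduced state on the second factor (system `A`) of a state on `E × A`. -/
def redSnd {iE iA : Type*} [Fintype iE] (τ : Matrix (iE × iA) (iE × iA) ℂ) :
    Matrix iA iA ℂ :=
  Matrix.of fun a b => ∑ e : iE, τ (e, a) (e, b)

lemma mlog_mul_of_mul {n m : Type*} [Fintype n] [DecidableEq n] [Fintype m] [DecidableEq m]
    (M : Matrix n n ℂ) (h : M.IsHermitian) (X : Matrix n m ℂ) (d : m → ℝ)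
    (hX : M * X = X * Matrix.diagonal (fun i => (d i : ℂ))) :
    mlog M * X = X * Matrix.diagonal (fun i => (Real.log (d i) : ℂ)) := by
  unfold mlog
  rw [dif_pos h]
  set U : Matrix n n ℂ := (h.eigenvectorUnitary : Matrix n n ℂ) with hU
  have hUU : Uᴴ * U = 1 := by
    rw [← Matrix.star_eq_conjTranspose]
    exact Unitary.coe_star_mul_self h.eigenvectorUnitary
  have hUU2 : U * Uᴴ = 1 := mul_eq_one_comm.mp hUU
  have hspec : M = U * Matrix.diagonal (fun i => (h.eigenvalues i : ℂ)) * Uᴴ := by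
    have := h.spectral_theorem
    rw [Unitary.conjStarAlgAut_apply] at this
    exact this
  have h1 : Matrix.diagonal (fun i => (h.eigenvalues i : ℂ)) * (Uᴴ * X)
      = (Uᴴ * X) * Matrix.diagonal (fun i => (d i : ℂ)) := by
    have : Uᴴ * (M * X) = Uᴴ * (X * Matrix.diagonal (fun i => (d i : ℂ))) := by rw [hX]
    rw [Matrix.mul_assoc Uᴴ X, ← this]
    nth_rewrite 2 [hspec]
    simp only [← Matrix.mul_assoc]
    rw [hUU, Matrix.one_mul]
  have h2 : Matrix.diagonal (fun i => (Real.log (h.eigenvalues i) : ℂ)) * (Uᴴ * X)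
      = (Uᴴ * X) * Matrix.diagonal (fun i => (Real.log (d i) : ℂ)) := by
    ext i j
    have := congrFun (congrFun h1 i) j
    rw [Matrix.diagonal_mul, Matrix.mul_diagonal] at this ⊢
    by_cases hz : (Uᴴ * X) i j = 0
    · simp [hz]
    · rw [mul_comm] at this
      have := mul_left_cancel₀ hz this
      have : h.eigenvalues i = d j := by exact_mod_cast this
      rw [this, mul_comm]
  rw [Matrix.mul_assoc, Matrix.mul_assoc, h2, ← Matrix.mul_assoc, ← Matrix.mul_assoc, hUU2,
    Matrix.one_mul]

lemma mlog_conj {n m : Type*} [Fintype n] [DecidableEq n] [Fintype m] [DecidableEq m]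
    (W : Matrix n m ℂ) (hW : Wᴴ * W = 1) (d : m → ℝ) :
    mlog (W * Matrix.diagonal (fun i => (d i : ℂ)) * Wᴴ)
      = W * Matrix.diagonal (fun i => (Real.log (d i) : ℂ)) * Wᴴ := by
  set M := W * Matrix.diagonal (fun i => (d i : ℂ)) * Wᴴ with hM
  have hH : M.IsHermitian := by
    apply Matrix.isHermitian_mul_mul_conjTranspose
    rw [Matrix.isHermitian_diagonal_iff]
    intro i
    simp [IsSelfAdjoint]
  have h1 := mlog_mul_of_mul M hH W d (by rw [hM, Matrix.mul_assoc, hW, Matrix.mul_one])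
  have h2 := mlog_mul_of_mul M hH (1 - W * Wᴴ) (fun _ => 0) (by
    have : M * (W * Wᴴ) = M := by
      rw [hM, Matrix.mul_assoc, ← Matrix.mul_assoc Wᴴ, hW, Matrix.one_mul]
    rw [Matrix.mul_sub, this]
    simp)
  have h3 : mlog M = mlog M * W * Wᴴ := by
    rw [Matrix.mul_sub] at h2
    simp only [Real.log_zero, Complex.ofReal_zero, Matrix.diagonal_zero, Matrix.mul_zero,
      Matrix.mul_one] at h2
    rw [Matrix.mul_assoc]
    exact sub_eq_zero.mp h2
  rw [h3, h1]

lemma vN_isometry {n m : Type*} [Fintype n] [DecidableEq n] [Fintype m] [DecidableEq m]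
    (V : Matrix n m ℂ) (hV : Vᴴ * V = 1) (ρ : Matrix m m ℂ) (h : ρ.IsHermitian) :
    vN (V * ρ * Vᴴ) = vN ρ := by
  have key : mlog (V * ρ * Vᴴ) = V * mlog ρ * Vᴴ := by
    set U : Matrix m m ℂ := (h.eigenvectorUnitary : Matrix m m ℂ) with hU
    have hUU : Uᴴ * U = 1 := by
      rw [← Matrix.star_eq_conjTranspose]
      exact Unitary.coe_star_mul_self h.eigenvectorUnitary
    have hspec : ρ = U * Matrix.diagonal (fun i => (h.eigenvalues i : ℂ)) * Uᴴ := by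
      have := h.spectral_theorem
      rw [Unitary.conjStarAlgAut_apply] at this
      exact this
    have hW : (V * U)ᴴ * (V * U) = 1 := by
      rw [Matrix.conjTranspose_mul, Matrix.mul_assoc, ← Matrix.mul_assoc Vᴴ, hV, Matrix.one_mul,
        hUU]
    have h1 := mlog_conj (V * U) hW h.eigenvalues
    have h2 : mlog ρ = U * Matrix.diagonal (fun i => (Real.log (h.eigenvalues i) : ℂ)) * Uᴴ := by
      unfold mlog
      rw [dif_pos h]
    have h3 : V * ρ * Vᴴ
        = V * U * Matrix.diagonal (fun i => (h.eigenvalues i : ℂ)) * (V * U)ᴴ := by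
      conv_lhs => rw [hspec]
      simp only [Matrix.conjTranspose_mul, Matrix.mul_assoc]
    rw [h3, h1, h2]
    simp only [Matrix.conjTranspose_mul, Matrix.mul_assoc]
  unfold vN
  rw [key]
  have : V * ρ * Vᴴ * (V * mlog ρ * Vᴴ) = V * (ρ * mlog ρ * Vᴴ) := by
    calc V * ρ * Vᴴ * (V * mlog ρ * Vᴴ) = V * ρ * (Vᴴ * V) * mlog ρ * Vᴴ := by
          simp only [Matrix.mul_assoc]
      _ = _ := by rw [hV]; simp only [Matrix.mul_assoc, Matrix.one_mul]
  rw [this, Matrix.trace_mul_comm, Matrix.mul_assoc, hV, Matrix.mul_one]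

lemma basis_sum {iA : Type*} [Fintype iA] [DecidableEq iA] (g : iA → iA → ℂ)
    (hg : ∀ l m, star (g l) ⬝ᵥ g m = if l = m then 1 else 0) (l m : iA) :
    ∑ e, star (g l e) * g m e = if l = m then 1 else 0 := by
  rw [← hg]; rfl

lemma Vdil_apply_sum {iA : Type*} [Fintype iA] [DecidableEq iA] (g : iA → iA → ℂ)
    (hg : ∀ l m, star (g l) ⬝ᵥ g m = if l = m then 1 else 0) (a b i j : iA) :
    ∑ e, Vdil g (e, a) i * star (Vdil g (e, b) j)
      = ∑ k, g k a * star (g k i) * (star (g k b) * g k j) := by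
  have : ∀ e, Vdil g (e, a) i * star (Vdil g (e, b) j)
      = ∑ k, ∑ l, (g k a * star (g k i) * (star (g l b) * g l j)) * (star (g l e) * g k e) := by
    intro e
    simp only [Vdil, Matrix.of_apply, star_sum, Finset.sum_mul_sum, star_mul', star_star]
    refine Finset.sum_congr rfl fun k _ => Finset.sum_congr rfl fun l _ => ?_
    ring
  simp only [this]
  rw [Finset.sum_comm]
  refine Finset.sum_congr rfl fun k _ => ?_
  rw [Finset.sum_comm]
  simp only [← Finset.mul_sum, basis_sum g hg]
  simp

lemma Vdil_isometry {iA : Type*} [Fintype iA] [DecidableEq iA] (g : iA → iA → ℂ)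
    (hg : ∀ l m, star (g l) ⬝ᵥ g m = if l = m then 1 else 0)
    (hgc : ∑ l, proj (g l) = (1 : Matrix iA iA ℂ)) :
    (Vdil g)ᴴ * Vdil g = 1 := by
  rw [← hgc]
  ext i j
  rw [Matrix.mul_apply, Fintype.sum_prod_type, Finset.sum_comm]
  simp only [Matrix.conjTranspose_apply]
  have : ∀ a, ∑ e, star (Vdil g (e, a) i) * Vdil g (e, a) j
      = ∑ k, g k i * star (g k j) * (star (g k a) * g k a) := by
    intro a
    simp only [mul_comm (star (Vdil g _ i))]
    rw [Vdil_apply_sum g hg]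
    refine Finset.sum_congr rfl fun k _ => ?_
    ring
  simp only [this]
  rw [Finset.sum_comm]
  simp only [← Finset.mul_sum, basis_sum g hg]
  simp [proj, Matrix.sum_apply, Matrix.vecMulVec_apply]

lemma redSnd_Vdil {iA : Type*} [Fintype iA] [DecidableEq iA] (g : iA → iA → ℂ)
    (hg : ∀ l m, star (g l) ⬝ᵥ g m = if l = m then 1 else 0) (ρ : Matrix iA iA ℂ) :
    redSnd (Vdil g * ρ * (Vdil g)ᴴ) = pinch g ρ := by
  ext a b
  have h1 : redSnd (Vdil g * ρ * (Vdil g)ᴴ) a b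
      = ∑ e, ∑ j, ∑ i, ρ i j * (Vdil g (e, a) i * star (Vdil g (e, b) j)) := by
    simp only [redSnd, Matrix.of_apply, Matrix.mul_apply, Matrix.conjTranspose_apply,
      Finset.sum_mul]
    refine Finset.sum_congr rfl fun e _ => Finset.sum_congr rfl fun j _ =>
      Finset.sum_congr rfl fun i _ => ?_
    ring
  have h2 : pinch g ρ a b
      = ∑ k, ∑ j, ∑ i, ρ i j * (g k a * star (g k i) * (star (g k b) * g k j)) := by
    simp only [pinch, Matrix.sum_apply, Matrix.smul_apply, proj, Matrix.vecMulVec_apply,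
      dotProduct, Matrix.mulVec, Pi.star_apply, smul_eq_mul, Finset.mul_sum, Finset.sum_mul]
    refine Finset.sum_congr rfl fun k _ => ?_
    rw [Finset.sum_comm]
    refine Finset.sum_congr rfl fun j _ => Finset.sum_congr rfl fun i _ => ?_
    ring
  rw [h1, h2, Finset.sum_comm, Finset.sum_comm (γ := iA) (s := Finset.univ (α := iA))]
  rw [Finset.sum_comm]
  refine (Finset.sum_congr rfl fun j _ => ?_).trans Finset.sum_comm
  rw [Finset.sum_comm]
  refine (Finset.sum_congr rfl fun i _ => ?_).trans Finset.sum_comm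
  rw [← Finset.mul_sum, Vdil_apply_sum g hg, Finset.mul_sum]

lemma trace_mlog_pinch {iA : Type*} [Fintype iA] [DecidableEq iA]
    (ρ : Matrix iA iA ℂ) (hρ : ρ.IsHermitian) (g : iA → iA → ℂ)
    (hg : ∀ l m, star (g l) ⬝ᵥ g m = if l = m then 1 else 0) :
    (ρ * mlog (pinch g ρ)).trace = (pinch g ρ * mlog (pinch g ρ)).trace := by
  set W : Matrix iA iA ℂ := Matrix.of fun a k => g k a with hWdef
  have hW : Wᴴ * W = 1 := by
    ext l m
    simp only [Matrix.mul_apply, Matrix.conjTranspose_apply, hWdef, Matrix.of_apply,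
      basis_sum g hg, Matrix.one_apply]
  set p : iA → ℝ := fun k => ((Wᴴ * ρ * W) k k).re with hp
  have hpd : ∀ k, ((p k : ℝ) : ℂ) = (Wᴴ * ρ * W) k k := fun k =>
    (Matrix.isHermitian_conjTranspose_mul_mul W hρ).coe_re_apply_self k
  have hP : pinch g ρ = W * Matrix.diagonal (fun k => (p k : ℂ)) * Wᴴ := by
    ext a b
    simp only [hpd]
    rw [Matrix.mul_apply]
    simp only [Matrix.mul_diagonal]
    simp only [pinch, Matrix.sum_apply, Matrix.smul_apply, proj, Matrix.vecMulVec_apply,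
      Pi.star_apply, smul_eq_mul]
    refine Finset.sum_congr rfl fun k _ => ?_
    have : star (g k) ⬝ᵥ ρ *ᵥ g k = (Wᴴ * ρ * W) k k := by
      rw [Matrix.mul_assoc, Matrix.mul_apply]
      rfl
    rw [this]
    simp only [Matrix.conjTranspose_apply, hWdef, Matrix.of_apply]
    ring
  rw [hP, mlog_conj W hW]
  set L := Matrix.diagonal (fun k => (Real.log (p k) : ℂ)) with hL
  have e1 : (ρ * (W * L * Wᴴ)).trace = ((Wᴴ * ρ * W) * L).trace := by
    rw [← Matrix.mul_assoc, Matrix.trace_mul_comm]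
    simp only [Matrix.mul_assoc]
  have e2 : (W * Matrix.diagonal (fun k => (p k : ℂ)) * Wᴴ * (W * L * Wᴴ)).trace
      = (Matrix.diagonal (fun k => (p k : ℂ)) * L).trace := by
    rw [← Matrix.mul_assoc, Matrix.trace_mul_comm]
    congr 1
    calc _ = (Wᴴ * W) * Matrix.diagonal (fun k => (p k : ℂ)) * (Wᴴ * W) * L := by
          simp only [Matrix.mul_assoc]
      _ = _ := by rw [hW]; simp
  rw [e1, e2]
  simp only [Matrix.trace, Matrix.diag_apply, hL, Matrix.mul_diagonal, Matrix.diagonal_apply_eq,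
    hpd]

/-- **Proposition 1** (complementarity for the pinching): for every density operator `ρ`,
`D(ρ ‖ P_G(ρ)) = −S(E|A)_{VρV†}`, where `S(E|A) = S(EA) − S(A)`. -/
theorem relent_pinch_eq_neg_condEntropy
    {iA : Type*} [Fintype iA] [DecidableEq iA]
    (ρ : Matrix iA iA ℂ) (hρ : ρ.PosSemidef) (hρtr : ρ.trace = 1)
    (g : iA → iA → ℂ)
    (hg : ∀ l m, star (g l) ⬝ᵥ g m = if l = m then 1 else 0)
    (hgc : ∑ l, proj (g l) = (1 : Matrix iA iA ℂ)) :
    relent ρ (pinch g ρ)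
      = -(vN (Vdil g * ρ * (Vdil g)ᴴ) - vN (redSnd (Vdil g * ρ * (Vdil g)ᴴ))) := by
  rw [vN_isometry _ (Vdil_isometry g hg hgc) ρ hρ.isHermitian, redSnd_Vdil g hg]
  unfold relent vN
  rw [Matrix.mul_sub, Matrix.trace_sub, Complex.sub_re,
    trace_mlog_pinch ρ hρ.isHermitian g hg]
  ring
end
end

section
/- For any bipartite density operator σ_{AB} and the pinching P_G in the eigenbasis of a Hermitian operator G on H_A, one has S(A)_σ + S(AB)_{(P_G⊗id)(σ)} ≥ S(AB)_σ + S(A)_{(P_G⊗id)(σ)}, i.e. the entropy gain of the pinching on the joint state is at most its entropy gain on the marginal of A. -/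
open scoped Kronecker Classical ComplexOrder
open Matrix

noncomputable section

section Helpers

open Filter Topology

lemma trace_two_diag {n : Type*} [Fintype n] [DecidableEq n] (U V : Matrix n n ℂ) (a b : n → ℝ) :
    (Matrix.trace ((U * diagonal (fun i => (a i : ℂ)) * Uᴴ) *
      (V * diagonal (fun i => (b i : ℂ)) * Vᴴ))).re
      = ∑ j, ∑ i, Complex.normSq ((Vᴴ * U) j i) * a i * b j := by
  have h1 : Matrix.trace ((U * diagonal (fun i => (a i : ℂ)) * Uᴴ) *
      (V * diagonal (fun i => (b i : ℂ)) * Vᴴ)) =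
      Matrix.trace ((Vᴴ * U) * diagonal (fun i => (a i : ℂ)) * (Vᴴ * U)ᴴ *
        diagonal (fun i => (b i : ℂ))) := by
    rw [← Matrix.mul_assoc, Matrix.trace_mul_comm]
    simp only [conjTranspose_mul, conjTranspose_conjTranspose, Matrix.mul_assoc]
  rw [h1]
  simp only [Matrix.trace, Matrix.diag, Matrix.mul_diagonal]
  rw [Complex.re_sum]
  refine Finset.sum_congr rfl fun j _ => ?_
  rw [Matrix.mul_apply, Finset.sum_mul, Complex.re_sum]
  refine Finset.sum_congr rfl fun i _ => ?_
  rw [Matrix.mul_diagonal, conjTranspose_apply]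
  simp only [Complex.normSq_apply, Complex.star_def, Complex.mul_re, Complex.mul_im,
    Complex.ofReal_re, Complex.ofReal_im, Complex.conj_re, Complex.conj_im]
  ring

/-- The quadratic functional. -/
def Qf {n : Type*} [Fintype n] (t : ℝ) (ρ ω X : Matrix n n ℂ) : ℝ :=
  2 * (trace (ρ * Xᴴ)).re - (trace (ω * (X * Xᴴ))).re - t * (trace (ρ * (Xᴴ * X))).re

lemma Qf_coord {n : Type*} [Fintype n] [DecidableEq n] (t : ℝ) (U V Y : Matrix n n ℂ)
    (hU : Uᴴ * U = 1) (hV : Vᴴ * V = 1) (p q : n → ℝ) :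
    Qf t (U * diagonal (fun i => (p i : ℂ)) * Uᴴ) (V * diagonal (fun i => (q i : ℂ)) * Vᴴ)
      (V * Y * Uᴴ) = ∑ j, ∑ i, (2 * p i * ((Vᴴ * U) j i * star (Y j i)).re
        - (q j + t * p i) * Complex.normSq (Y j i)) := by
  have h1 : trace ((U * diagonal (fun i => (p i : ℂ)) * Uᴴ) * (V * Y * Uᴴ)ᴴ)
      = trace ((Vᴴ * U) * diagonal (fun i => (p i : ℂ)) * Yᴴ) := by
    have : (U * diagonal (fun i => (p i : ℂ)) * Uᴴ) * (V * Y * Uᴴ)ᴴ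
        = (U * diagonal (fun i => (p i : ℂ)) * (Uᴴ * U) * Yᴴ) * Vᴴ := by
      simp only [conjTranspose_mul, conjTranspose_conjTranspose, Matrix.mul_assoc]
    rw [this, hU, trace_mul_comm]
    simp only [Matrix.mul_assoc, Matrix.one_mul]
  have h2 : trace ((V * diagonal (fun i => (q i : ℂ)) * Vᴴ) * ((V * Y * Uᴴ) * (V * Y * Uᴴ)ᴴ))
      = trace (diagonal (fun i => (q i : ℂ)) * (Y * Yᴴ)) := by
    have : (V * diagonal (fun i => (q i : ℂ)) * Vᴴ) * ((V * Y * Uᴴ) * (V * Y * Uᴴ)ᴴ)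
        = (V * diagonal (fun i => (q i : ℂ)) * (Vᴴ * V) * Y * (Uᴴ * U) * Yᴴ) * Vᴴ := by
      simp only [conjTranspose_mul, conjTranspose_conjTranspose, Matrix.mul_assoc]
    rw [this, hU, hV, trace_mul_comm]
    simp only [← Matrix.mul_assoc, hV, Matrix.one_mul, Matrix.mul_one]
  have h3 : trace ((U * diagonal (fun i => (p i : ℂ)) * Uᴴ) * ((V * Y * Uᴴ)ᴴ * (V * Y * Uᴴ)))
      = trace (diagonal (fun i => (p i : ℂ)) * (Yᴴ * Y)) := by
    have : (U * diagonal (fun i => (p i : ℂ)) * Uᴴ) * ((V * Y * Uᴴ)ᴴ * (V * Y * Uᴴ))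
        = (U * diagonal (fun i => (p i : ℂ)) * (Uᴴ * U) * Yᴴ * (Vᴴ * V) * Y) * Uᴴ := by
      simp only [conjTranspose_mul, conjTranspose_conjTranspose, Matrix.mul_assoc]
    rw [this, hU, hV, trace_mul_comm]
    simp only [← Matrix.mul_assoc, hU, Matrix.one_mul, Matrix.mul_one]
  have e1 : (trace ((Vᴴ * U) * diagonal (fun i => (p i : ℂ)) * Yᴴ)).re
      = ∑ j, ∑ i, p i * ((Vᴴ * U) j i * star (Y j i)).re := by
    simp only [Matrix.trace, Matrix.diag]
    rw [Complex.re_sum]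
    refine Finset.sum_congr rfl fun j _ => ?_
    rw [Matrix.mul_apply, Complex.re_sum]
    refine Finset.sum_congr rfl fun i _ => ?_
    rw [Matrix.mul_diagonal, conjTranspose_apply]
    simp
    ring
  have e2 : (trace (diagonal (fun i => (q i : ℂ)) * (Y * Yᴴ))).re
      = ∑ j, ∑ i, q j * Complex.normSq (Y j i) := by
    simp only [Matrix.trace, Matrix.diag, Matrix.diagonal_mul]
    rw [Complex.re_sum]
    refine Finset.sum_congr rfl fun j _ => ?_
    rw [Matrix.mul_apply, Finset.mul_sum, Complex.re_sum]
    refine Finset.sum_congr rfl fun i _ => ?_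
    rw [conjTranspose_apply]
    simp [Complex.normSq_apply]
  have e3 : (trace (diagonal (fun i => (p i : ℂ)) * (Yᴴ * Y))).re
      = ∑ j, ∑ i, p i * Complex.normSq (Y j i) := by
    simp only [Matrix.trace, Matrix.diag, Matrix.diagonal_mul]
    rw [Complex.re_sum, Finset.sum_comm]
    refine Finset.sum_congr rfl fun j _ => ?_
    rw [Matrix.mul_apply, Finset.mul_sum, Complex.re_sum]
    refine Finset.sum_congr rfl fun i _ => ?_
    rw [conjTranspose_apply]
    simp [Complex.normSq_apply]
  rw [Qf, h1, h2, h3, e1, e2, e3]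
  simp only [Finset.mul_sum, ← Finset.sum_sub_distrib]
  refine Finset.sum_congr rfl fun j _ => Finset.sum_congr rfl fun i _ => ?_
  ring

/-- The optimal value. -/
def Ff {n : Type*} [Fintype n] (t : ℝ) (C : Matrix n n ℂ) (p q : n → ℝ) : ℝ :=
  ∑ j, ∑ i, Complex.normSq (C j i) * (p i * (p i / (q j + t * p i)))

lemma Qf_le {n : Type*} [Fintype n] [DecidableEq n] (t : ℝ) (ht : 0 < t) (U V X : Matrix n n ℂ)
    (hU : Uᴴ * U = 1) (hV : Vᴴ * V = 1) (p q : n → ℝ) (hp : ∀ i, 0 ≤ p i) (hq : ∀ i, 0 ≤ q i) :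
    Qf t (U * diagonal (fun i => (p i : ℂ)) * Uᴴ) (V * diagonal (fun i => (q i : ℂ)) * Vᴴ) X
      ≤ Ff t (Vᴴ * U) p q := by
  have hU' : U * Uᴴ = 1 := mul_eq_one_comm.mp hU
  have hV' : V * Vᴴ = 1 := mul_eq_one_comm.mp hV
  have hX : X = V * (Vᴴ * X * U) * Uᴴ := by
    have : V * (Vᴴ * X * U) * Uᴴ = (V * Vᴴ) * X * (U * Uᴴ) := by simp only [Matrix.mul_assoc]
    rw [this, hU', hV']; simp
  rw [hX, Qf_coord t U V _ hU hV, Ff]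
  refine Finset.sum_le_sum fun j _ => Finset.sum_le_sum fun i _ => ?_
  generalize (Vᴴ * U) j i = c
  generalize (Vᴴ * X * U) j i = y
  have hpi := hp i
  have hqj := hq j
  rcases (by positivity : 0 ≤ q j + t * p i).eq_or_lt with h | h
  · have : p i = 0 := by
      have : t * p i = 0 := by nlinarith [mul_nonneg ht.le hpi]
      rcases mul_eq_zero.mp this with h | h
      · exact absurd h ht.ne'
      · exact h
    rw [← h, this]; simp
  · have : Complex.normSq c * (p i * (p i / (q j + t * p i))) -
        (2 * p i * (c * star y).re - (q j + t * p i) * Complex.normSq y)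
        = ((p i * c.re - (q j + t * p i) * y.re)^2 + (p i * c.im - (q j + t * p i) * y.im)^2)
          / (q j + t * p i) := by
      simp only [Complex.normSq_apply, Complex.star_def, Complex.mul_re, Complex.conj_re,
        Complex.conj_im]
      have hne := h.ne'
      generalize q j + t * p i = d at hne
      field_simp
      ring
    have h2 : 0 ≤ ((p i * c.re - (q j + t * p i) * y.re)^2 +
      (p i * c.im - (q j + t * p i) * y.im)^2) / (q j + t * p i) := by positivity
    linarith

lemma Qf_attain {n : Type*} [Fintype n] [DecidableEq n] (t : ℝ) (ht : 0 < t) (U V : Matrix n n ℂ)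
    (hU : Uᴴ * U = 1) (hV : Vᴴ * V = 1) (p q : n → ℝ) (hp : ∀ i, 0 ≤ p i) (hq : ∀ i, 0 ≤ q i) :
    ∃ X, Qf t (U * diagonal (fun i => (p i : ℂ)) * Uᴴ) (V * diagonal (fun i => (q i : ℂ)) * Vᴴ) X
      = Ff t (Vᴴ * U) p q := by
  refine ⟨V * (Matrix.of fun j i => ((p i / (q j + t * p i) : ℝ) : ℂ) * (Vᴴ * U) j i) * Uᴴ, ?_⟩
  rw [Qf_coord t U V _ hU hV, Ff]
  refine Finset.sum_congr rfl fun j _ => Finset.sum_congr rfl fun i _ => ?_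
  rw [Matrix.of_apply]
  generalize (Vᴴ * U) j i = c
  have hpi := hp i
  have hqj := hq j
  rcases (by positivity : 0 ≤ q j + t * p i).eq_or_lt with h | h
  · rw [← h]; simp
  · simp only [Complex.normSq_apply, star_mul', Complex.star_def, Complex.conj_ofReal,
      Complex.mul_re, Complex.mul_im, Complex.ofReal_re, Complex.ofReal_im, Complex.conj_re,
      Complex.conj_im]
    have hne := h.ne'
    generalize q j + t * p i = d at hne
    field_simp
    ring

section red
variable {iA iB : Type*} [Fintype iA] [Fintype iB] [DecidableEq iA] [DecidableEq iB]

lemma redA2_kron (M N : Matrix iA iA ℂ) (ρ : Matrix (iA × iB) (iA × iB) ℂ) :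
    redA2 ((M ⊗ₖ (1 : Matrix iB iB ℂ)) * ρ * (N ⊗ₖ (1 : Matrix iB iB ℂ))) = M * redA2 ρ * N := by
  ext i j
  simp only [redA2, Matrix.of_apply, Matrix.mul_apply, Fintype.sum_prod_type, kroneckerMap_apply,
    Matrix.one_apply, mul_ite, mul_one, mul_zero, ite_mul, zero_mul, Finset.sum_ite_eq,
    Finset.sum_ite_eq', Finset.mem_univ, if_true, Finset.mul_sum, Finset.sum_mul]
  rw [Finset.sum_comm]
  refine Finset.sum_congr rfl fun x _ => ?_
  rw [Finset.sum_comm]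

lemma redA2_trace (ρ : Matrix (iA × iB) (iA × iB) ℂ) : trace (redA2 ρ) = trace ρ := by
  simp [redA2, Matrix.trace, Fintype.sum_prod_type]

lemma redA2_trace_mul (ρ : Matrix (iA × iB) (iA × iB) ℂ) (X : Matrix iA iA ℂ) :
    trace (redA2 ρ * X) = trace (ρ * (X ⊗ₖ (1 : Matrix iB iB ℂ))) := by
  have := redA2_kron (1 : Matrix iA iA ℂ) X ρ
  rw [Matrix.one_mul] at this
  rw [← this, redA2_trace]
  simp

lemma redA2_posSemidef {ρ : Matrix (iA × iB) (iA × iB) ℂ} (h : ρ.PosSemidef) :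
    (redA2 ρ).PosSemidef := by
  have : redA2 ρ = ∑ b : iB, ρ.submatrix (fun a => (a, b)) (fun a => (a, b)) := by
    ext i j
    simp [redA2, Matrix.sum_apply]
  rw [this]
  exact Matrix.posSemidef_sum _ fun b _ => h.submatrix _

lemma Qf_red (t : ℝ) (ρ ω : Matrix (iA × iB) (iA × iB) ℂ) (X : Matrix iA iA ℂ) :
    Qf t (redA2 ρ) (redA2 ω) X = Qf t ρ ω (X ⊗ₖ (1 : Matrix iB iB ℂ)) := by
  simp only [Qf, redA2_trace_mul, conjTranspose_kronecker, conjTranspose_one,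
    ← Matrix.mul_kronecker_mul, Matrix.one_mul]

end red

/-- Interpolating function. -/
def Phi {n : Type*} [Fintype n] (C : Matrix n n ℂ) (p q : n → ℝ) (T : ℝ) : ℝ :=
  ∑ j, ∑ i, Complex.normSq (C j i) * p i * Real.log (q j + T * p i)

lemma Phi_cont {n : Type*} [Fintype n] (C : Matrix n n ℂ) (p q : n → ℝ) (hp : ∀ i, 0 ≤ p i)
    (hq : ∀ i, 0 ≤ q i) (hs : ∀ j i, q j = 0 → Complex.normSq (C j i) * p i = 0) :
    ContinuousOn (Phi C p q) (Set.Ici 0) := by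
  unfold Phi
  refine continuousOn_finsetSum _ fun j _ => continuousOn_finsetSum _ fun i _ => ?_
  by_cases h : q j = 0
  · simp only [hs j i h, zero_mul]; exact continuousOn_const
  · refine continuousOn_const.mul (ContinuousOn.log (by fun_prop) fun T hT => ?_)
    have := (hq j).lt_of_ne' h
    have hpi := hp i
    have hT : 0 ≤ T := hT
    positivity

lemma Phi_deriv {n : Type*} [Fintype n] (C : Matrix n n ℂ) (p q : n → ℝ) (hp : ∀ i, 0 ≤ p i)
    (hq : ∀ i, 0 ≤ q i) (hs : ∀ j i, q j = 0 → Complex.normSq (C j i) * p i = 0)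
    (T : ℝ) (hT : 0 < T) : HasDerivAt (Phi C p q) (Ff T C p q) T := by
  unfold Phi Ff
  refine HasDerivAt.fun_sum fun j _ => HasDerivAt.fun_sum fun i _ => ?_
  by_cases h : q j = 0
  · simp only [← mul_assoc, hs j i h, zero_mul]
    exact hasDerivAt_const _ _
  · have := (hq j).lt_of_ne' h
    have hpi := hp i
    have h0 : q j + T * p i ≠ 0 := by positivity
    have h1 : HasDerivAt (fun T => q j + T * p i) (p i) T := by
      simpa using ((hasDerivAt_id T).mul_const (p i)).const_add (q j)
    have := (h1.log h0).const_mul (Complex.normSq (C j i) * p i)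
    rwa [← mul_assoc]

lemma Phi_lim {n : Type*} [Fintype n] (C : Matrix n n ℂ) (p q : n → ℝ) (hp : ∀ i, 0 ≤ p i)
    (hq : ∀ i, 0 ≤ q i) :
    Tendsto (fun T => Phi C p q T - (∑ j, ∑ i, Complex.normSq (C j i) * p i) * Real.log T) atTop
      (𝓝 (∑ j, ∑ i, Complex.normSq (C j i) * p i * Real.log (p i))) := by
  have h1 : ∀ T, Phi C p q T - (∑ j, ∑ i, Complex.normSq (C j i) * p i) * Real.log T =
      ∑ j, ∑ i, (Complex.normSq (C j i) * p i * (Real.log (q j + T * p i) - Real.log T)) := by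
    intro T
    simp only [Phi, Finset.sum_mul, ← Finset.sum_sub_distrib, mul_sub]
  simp only [h1]
  refine tendsto_finsetSum _ fun j _ => tendsto_finsetSum _ fun i _ => ?_
  rcases (hp i).eq_or_lt with h | h
  · simp [← h]
  · refine Tendsto.const_mul _ ?_
    have h2 : Tendsto (fun T : ℝ => Real.log (q j / T + p i)) atTop (𝓝 (Real.log (p i))) := by
      have : Tendsto (fun T : ℝ => q j / T + p i) atTop (𝓝 (0 + p i)) :=
        (tendsto_const_nhds.div_atTop tendsto_id).add tendsto_const_nhds
      rw [zero_add] at this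
      exact this.log h.ne'
    refine h2.congr' ?_
    filter_upwards [eventually_gt_atTop 0] with T hT
    have hqj := hq j
    rw [← Real.log_div (by positivity) hT.ne']
    congr 1
    field_simp

/-- Abstract comparison. -/
lemma Phi_compare {n m : Type*} [Fintype n] [Fintype m] (C : Matrix n n ℂ) (p q : n → ℝ)
    (C' : Matrix m m ℂ) (p' q' : m → ℝ) (hp : ∀ i, 0 ≤ p i)
    (hq : ∀ i, 0 ≤ q i) (hs : ∀ j i, q j = 0 → Complex.normSq (C j i) * p i = 0)
    (hp' : ∀ i, 0 ≤ p' i)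
    (hq' : ∀ i, 0 ≤ q' i) (hs' : ∀ j i, q' j = 0 → Complex.normSq (C' j i) * p' i = 0)
    (htr : ∑ j, ∑ i, Complex.normSq (C j i) * p i = ∑ j, ∑ i, Complex.normSq (C' j i) * p' i)
    (hF : ∀ t, 0 < t → Ff t C' p' q' ≤ Ff t C p q) :
    (∑ j, ∑ i, Complex.normSq (C' j i) * p' i * Real.log (p' i)) -
      (∑ j, ∑ i, Complex.normSq (C' j i) * p' i * Real.log (q' j)) ≤
    (∑ j, ∑ i, Complex.normSq (C j i) * p i * Real.log (p i)) -
      (∑ j, ∑ i, Complex.normSq (C j i) * p i * Real.log (q j)) := by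
  have hmono : MonotoneOn (fun T => Phi C p q T - Phi C' p' q' T) (Set.Ici 0) := by
    refine monotoneOn_of_hasDerivWithinAt_nonneg (f' := fun T => Ff T C p q - Ff T C' p' q')
      (convex_Ici 0) ((Phi_cont C p q hp hq hs).sub (Phi_cont C' p' q' hp' hq' hs')) ?_ ?_
    · intro T hT
      rw [interior_Ici] at hT
      exact ((Phi_deriv C p q hp hq hs T hT).sub
        (Phi_deriv C' p' q' hp' hq' hs' T hT)).hasDerivWithinAt
    · intro T hT
      rw [interior_Ici] at hT
      exact sub_nonneg.mpr (hF T hT)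
  have hlim := (Phi_lim C p q hp hq).sub (Phi_lim C' p' q' hp' hq')
  have hge : Phi C p q 0 - Phi C' p' q' 0 ≤
      (∑ j, ∑ i, Complex.normSq (C j i) * p i * Real.log (p i)) -
      (∑ j, ∑ i, Complex.normSq (C' j i) * p' i * Real.log (p' i)) := by
    refine ge_of_tendsto hlim ?_
    filter_upwards [eventually_ge_atTop 0] with T hT
    have := hmono (Set.mem_Ici.mpr le_rfl) (Set.mem_Ici.mpr hT) hT
    simp only at this
    rw [htr]
    linarith
  simp only [Phi, zero_mul, add_zero] at hge
  linarith

section spec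
variable {n : Type*} [Fintype n] [DecidableEq n]

lemma mlog_eq {ρ : Matrix n n ℂ} (h : ρ.IsHermitian) :
    mlog ρ = (h.eigenvectorUnitary : Matrix n n ℂ) *
      Matrix.diagonal (fun i => (Real.log (h.eigenvalues i) : ℂ)) *
      (h.eigenvectorUnitary : Matrix n n ℂ)ᴴ := by
  rw [mlog, dif_pos h]

lemma spec_eq {ρ : Matrix n n ℂ} (h : ρ.IsHermitian) :
    ρ = (h.eigenvectorUnitary : Matrix n n ℂ) *
      Matrix.diagonal (fun i => (h.eigenvalues i : ℂ)) *
      (h.eigenvectorUnitary : Matrix n n ℂ)ᴴ := by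
  have := h.spectral_theorem
  rw [Unitary.conjStarAlgAut_apply] at this
  exact this

lemma unit_eq {ρ : Matrix n n ℂ} (h : ρ.IsHermitian) :
    (h.eigenvectorUnitary : Matrix n n ℂ)ᴴ * (h.eigenvectorUnitary : Matrix n n ℂ) = 1 :=
  Unitary.coe_star_mul_self h.eigenvectorUnitary

lemma unit_eq' {ρ : Matrix n n ℂ} (h : ρ.IsHermitian) :
    (h.eigenvectorUnitary : Matrix n n ℂ) * (h.eigenvectorUnitary : Matrix n n ℂ)ᴴ = 1 :=
  Unitary.coe_mul_star_self h.eigenvectorUnitary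

lemma col_sum (U V : Matrix n n ℂ) (hU : Uᴴ * U = 1) (hV : Vᴴ * V = 1) (f : n → ℝ) :
    ∑ j, ∑ i, Complex.normSq ((Vᴴ * U) j i) * f i = (trace (U * diagonal (fun i => (f i : ℂ)) * Uᴴ)).re := by
  have h := trace_two_diag U V f (fun _ => 1)
  simp only [mul_one] at h
  rw [← h]
  have hV' : V * Vᴴ = 1 := mul_eq_one_comm.mp hV
  have : diagonal (fun _ : n => ((1 : ℝ) : ℂ)) = 1 := by simp
  rw [this, Matrix.mul_one, hV', Matrix.mul_one]

lemma relent_sum {ρ ω : Matrix n n ℂ} (h : ρ.IsHermitian) (k : ω.IsHermitian) :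
    (trace (ρ * mlog ω)).re = ∑ j, ∑ i, Complex.normSq (((k.eigenvectorUnitary : Matrix n n ℂ)ᴴ *
      (h.eigenvectorUnitary : Matrix n n ℂ)) j i) * h.eigenvalues i *
        Real.log (k.eigenvalues j) := by
  rw [← trace_two_diag, ← spec_eq h, ← mlog_eq k]

lemma self_sum {ρ ω : Matrix n n ℂ} (h : ρ.IsHermitian) (k : ω.IsHermitian) :
    (trace (ρ * mlog ρ)).re = ∑ j, ∑ i, Complex.normSq (((k.eigenvectorUnitary : Matrix n n ℂ)ᴴ *
      (h.eigenvectorUnitary : Matrix n n ℂ)) j i) * h.eigenvalues i *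
        Real.log (h.eigenvalues i) := by
  simp only [mul_assoc]
  rw [col_sum _ _ (unit_eq h) (unit_eq k) (fun i => h.eigenvalues i * Real.log (h.eigenvalues i))]
  conv_lhs => rw [mlog_eq h]
  congr 2
  nth_rw 1 [spec_eq h]
  set U := (h.eigenvectorUnitary : Matrix n n ℂ)
  have : U * diagonal (fun i => (h.eigenvalues i : ℂ)) * Uᴴ *
      (U * diagonal (fun i => (Real.log (h.eigenvalues i) : ℂ)) * Uᴴ) =
      U * (diagonal (fun i => (h.eigenvalues i : ℂ)) * (Uᴴ * U) *
        diagonal (fun i => (Real.log (h.eigenvalues i) : ℂ))) * Uᴴ := by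
    simp only [Matrix.mul_assoc]
  rw [this, unit_eq h, Matrix.mul_one, diagonal_mul_diagonal]
  simp

lemma supp_cond {ρ ω : Matrix n n ℂ} (h : ρ.IsHermitian) (k : ω.IsHermitian)
    (hs : ∀ v, ω *ᵥ v = 0 → ρ *ᵥ v = 0) (j i : n) (hj : k.eigenvalues j = 0) :
    Complex.normSq (((k.eigenvectorUnitary : Matrix n n ℂ)ᴴ *
      (h.eigenvectorUnitary : Matrix n n ℂ)) j i) * h.eigenvalues i = 0 := by
  set U := (h.eigenvectorUnitary : Matrix n n ℂ) with hUdef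
  set V := (k.eigenvectorUnitary : Matrix n n ℂ) with hVdef
  have h1 : ω *ᵥ (V *ᵥ Pi.single j 1) = 0 := by
    rw [mulVec_mulVec]
    conv_lhs => rw [spec_eq k]
    rw [Matrix.mul_assoc, unit_eq k, Matrix.mul_one]
    ext x
    simp [Matrix.mul_diagonal, hj]
  have h2 := hs _ h1
  have h3 : ρ * V = U * diagonal (fun i => (h.eigenvalues i : ℂ)) * (Vᴴ * U)ᴴ := by
    conv_lhs => rw [spec_eq h]
    simp [Matrix.mul_assoc, U]
  have h4 : (diagonal (fun i => (h.eigenvalues i : ℂ)) * (Vᴴ * U)ᴴ) *ᵥ Pi.single j 1 = 0 := by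
    have : (diagonal (fun i => (h.eigenvalues i : ℂ)) * (Vᴴ * U)ᴴ) = Uᴴ * (ρ * V) := by
      rw [h3, ← Matrix.mul_assoc, ← Matrix.mul_assoc, unit_eq h, Matrix.one_mul]
    rw [this, ← mulVec_mulVec, ← mulVec_mulVec, h2, mulVec_zero]
  have h5 := congrFun h4 i
  simp only [mulVec_single_one, Pi.zero_apply, Matrix.col_apply, diagonal_mul,
    conjTranspose_apply, mul_eq_zero, star_eq_zero, Complex.ofReal_eq_zero] at h5
  rcases h5 with h5 | h5
  · rw [h5, mul_zero]
  · rw [h5]; simp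

lemma mlog_commute {ω M : Matrix n n ℂ} (k : ω.IsHermitian) (hM : M * ω = ω * M) :
    M * mlog ω = mlog ω * M := by
  set V := (k.eigenvectorUnitary : Matrix n n ℂ) with hVdef
  have hV : Vᴴ * V = 1 := unit_eq k
  have hV' : V * Vᴴ = 1 := unit_eq' k
  have key : ∀ D : Matrix n n ℂ, M * (V * D * Vᴴ) = (V * D * Vᴴ) * M ↔
      (Vᴴ * M * V) * D = D * (Vᴴ * M * V) := by
    intro D
    constructor
    · intro e
      have e2 : Vᴴ * (M * (V * D * Vᴴ)) * V = Vᴴ * ((V * D * Vᴴ) * M) * V := by rw [e]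
      have a1 : Vᴴ * (M * (V * D * Vᴴ)) * V = (Vᴴ * M * V) * D * (Vᴴ * V) := by
        simp only [Matrix.mul_assoc]
      have a2 : Vᴴ * ((V * D * Vᴴ) * M) * V = (Vᴴ * V) * D * (Vᴴ * M * V) := by
        simp only [Matrix.mul_assoc]
      rw [a1, a2, hV, Matrix.mul_one, Matrix.one_mul] at e2
      exact e2
    · intro e
      have e2 : V * ((Vᴴ * M * V) * D) * Vᴴ = V * (D * (Vᴴ * M * V)) * Vᴴ := by rw [e]
      have a1 : V * ((Vᴴ * M * V) * D) * Vᴴ = (V * Vᴴ) * (M * (V * D * Vᴴ)) := by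
        simp only [Matrix.mul_assoc]
      have a2 : V * (D * (Vᴴ * M * V)) * Vᴴ = ((V * D * Vᴴ) * M) * (V * Vᴴ) := by
        simp only [Matrix.mul_assoc]
      rw [a1, a2, hV', Matrix.mul_one, Matrix.one_mul] at e2
      exact e2
  rw [mlog_eq k]
  refine (key _).mpr ?_
  have h1 : M * (V * diagonal (fun i => (k.eigenvalues i : ℂ)) * Vᴴ) =
      (V * diagonal (fun i => (k.eigenvalues i : ℂ)) * Vᴴ) * M := by
    rw [← spec_eq k]; exact hM
  have h2 := (key _).mp h1
  ext i j
  have h3 := congrFun (congrFun h2 i) j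
  rw [Matrix.mul_diagonal, Matrix.diagonal_mul] at h3 ⊢
  by_cases e : k.eigenvalues i = k.eigenvalues j
  · rw [e, mul_comm]
  · have : (Vᴴ * M * V) i j = 0 := by
      have h4 : ((k.eigenvalues i : ℂ) - k.eigenvalues j) * (Vᴴ * M * V) i j = 0 := by
        linear_combination -h3
      rcases mul_eq_zero.mp h4 with h | h
      · exact absurd (by exact_mod_cast sub_eq_zero.mp h) e
      · exact h
    rw [this]; simp

lemma pinch_posSemidef {ι : Type*} [Fintype ι] {ρ : Matrix n n ℂ} (h : ρ.PosSemidef)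
    (P : ι → Matrix n n ℂ) (hP : ∀ l, (P l)ᴴ = P l) : (∑ l, P l * ρ * P l).PosSemidef := by
  refine Matrix.posSemidef_sum _ fun l _ => ?_
  have := h.conjTranspose_mul_mul_same (P l)
  rwa [hP] at this

lemma pinch_trace {ι : Type*} [Fintype ι] [DecidableEq ι] {ρ : Matrix n n ℂ} (h : ρ.PosSemidef)
    (P : ι → Matrix n n ℂ) (hP : ∀ l, (P l)ᴴ = P l)
    (hPP : ∀ l m, P l * P m = if l = m then P l else 0) (hP1 : ∑ l, P l = 1) :
    trace (ρ * mlog (∑ l, P l * ρ * P l)) =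
      trace ((∑ l, P l * ρ * P l) * mlog (∑ l, P l * ρ * P l)) := by
  set ω := ∑ l, P l * ρ * P l with hω
  have k : ω.IsHermitian := (pinch_posSemidef h P hP).isHermitian
  have hc : ∀ l, P l * mlog ω = mlog ω * P l := by
    intro l
    refine mlog_commute k ?_
    have a : P l * ω = P l * ρ * P l := by
      rw [hω, Finset.mul_sum]
      simp only [← Matrix.mul_assoc, hPP, ite_mul, zero_mul]
      simp
    have b : ω * P l = P l * ρ * P l := by
      rw [hω, Finset.sum_mul]
      simp only [Matrix.mul_assoc, hPP, mul_ite, mul_zero]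
      simp
    rw [a, b]
  have h1 : trace (ω * mlog ω) = ∑ l, trace (ρ * mlog ω * P l) := by
    nth_rw 1 [hω]
    rw [Finset.sum_mul, trace_sum]
    refine Finset.sum_congr rfl fun l _ => ?_
    have : P l * ρ * P l * mlog ω = P l * (ρ * mlog ω * P l) := by
      simp only [Matrix.mul_assoc, hc l]
    rw [this, trace_mul_comm]
    have : P l * P l = P l := by rw [hPP, if_pos rfl]
    rw [Matrix.mul_assoc, this]
  rw [h1, ← trace_sum, ← Finset.mul_sum, hP1, Matrix.mul_one]

lemma pinch_supp {ι : Type*} [Fintype ι] {ρ : Matrix n n ℂ} (h : ρ.PosSemidef)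
    (P : ι → Matrix n n ℂ) (hP : ∀ l, (P l)ᴴ = P l) (hP1 : ∑ l, P l = 1) (v : n → ℂ)
    (hv : (∑ l, P l * ρ * P l) *ᵥ v = 0) : ρ *ᵥ v = 0 := by
  have h1 : ∑ l, star (P l *ᵥ v) ⬝ᵥ (ρ *ᵥ (P l *ᵥ v)) = 0 := by
    have h2 : star v ⬝ᵥ ((∑ l, P l * ρ * P l) *ᵥ v) = 0 := by rw [hv, dotProduct_zero]
    rw [Matrix.sum_mulVec, dotProduct_sum] at h2
    rw [← h2]
    refine Finset.sum_congr rfl fun l _ => ?_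
    rw [star_mulVec, hP, ← dotProduct_mulVec, mulVec_mulVec, mulVec_mulVec, Matrix.mul_assoc]
  have h3 := (Finset.sum_eq_zero_iff_of_nonneg
    (fun l _ => h.dotProduct_mulVec_nonneg (P l *ᵥ v))).mp h1
  have h4 : ∀ l, ρ *ᵥ (P l *ᵥ v) = 0 := fun l =>
    (h.dotProduct_mulVec_zero_iff _).mp (h3 l (Finset.mem_univ l))
  have h5 : ρ *ᵥ v = ∑ l, ρ *ᵥ (P l *ᵥ v) := by
    rw [← Matrix.mulVec_sum, ← Matrix.sum_mulVec, hP1, one_mulVec]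
  rw [h5]
  exact Finset.sum_eq_zero fun l _ => h4 l

end spec

/-- Monotonicity of relative entropy under partial trace. -/
lemma relent_mono {iA iB : Type*} [Fintype iA] [Fintype iB] [DecidableEq iA] [DecidableEq iB]
    (ρ ω : Matrix (iA × iB) (iA × iB) ℂ) (hρ : ρ.PosSemidef) (hω : ω.PosSemidef)
    (hs : ∀ v, ω *ᵥ v = 0 → ρ *ᵥ v = 0)
    (hs' : ∀ v, redA2 ω *ᵥ v = 0 → redA2 ρ *ᵥ v = 0) :
    (trace (redA2 ρ * mlog (redA2 ρ))).re - (trace (redA2 ρ * mlog (redA2 ω))).re ≤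
    (trace (ρ * mlog ρ)).re - (trace (ρ * mlog ω)).re := by
  have hρA := redA2_posSemidef hρ
  have hωA := redA2_posSemidef hω
  rw [self_sum hρ.isHermitian hω.isHermitian, self_sum hρA.isHermitian hωA.isHermitian,
    relent_sum hρ.isHermitian hω.isHermitian, relent_sum hρA.isHermitian hωA.isHermitian]
  refine Phi_compare _ _ _ _ _ _ hρ.eigenvalues_nonneg hω.eigenvalues_nonneg
    (supp_cond _ _ hs) hρA.eigenvalues_nonneg hωA.eigenvalues_nonneg (supp_cond _ _ hs') ?_ ?_
  · rw [col_sum _ _ (unit_eq _) (unit_eq _), col_sum _ _ (unit_eq _) (unit_eq _), ← spec_eq,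
      ← spec_eq, redA2_trace]
  · intro t ht
    obtain ⟨X, hX⟩ := Qf_attain t ht _ _ (unit_eq hρA.isHermitian) (unit_eq hωA.isHermitian)
      _ _ hρA.eigenvalues_nonneg hωA.eigenvalues_nonneg
    rw [← hX, ← spec_eq, ← spec_eq, Qf_red]
    have := Qf_le t ht _ _ (X ⊗ₖ (1 : Matrix iB iB ℂ)) (unit_eq hρ.isHermitian)
      (unit_eq hω.isHermitian) _ _ hρ.eigenvalues_nonneg hω.eigenvalues_nonneg
    rwa [← spec_eq, ← spec_eq] at this

end Helpers

/-- **Eq. (nontriv)**: for any bipartite density operator `σ_{AB}` and the pinching `P_G` on `A`,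
`S(A)_σ + S(AB)_{(P_G⊗id)(σ)} ≥ S(AB)_σ + S(A)_{(P_G⊗id)(σ)}`. -/
theorem pinching_entropy_gain_joint_le_marginal
    {iA iB : Type*} [Fintype iA] [Fintype iB] [DecidableEq iA] [DecidableEq iB]
    (σ : Matrix (iA × iB) (iA × iB) ℂ)
    (hσ : σ.PosSemidef) (hσtr : σ.trace = 1)
    (g : iA → iA → ℂ)
    (hg : ∀ l m, star (g l) ⬝ᵥ g m = if l = m then 1 else 0)
    (hgc : ∑ l, proj (g l) = (1 : Matrix iA iA ℂ)) :
    vN (redA2 σ) + vN (omega2 g σ) ≥ vN σ + vN (redA2 (omega2 g σ)) := by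
  have hP : ∀ l, (proj (g l))ᴴ = proj (g l) := fun l => by
    simp [proj, conjTranspose_vecMulVec]
  have hPP : ∀ l m, proj (g l) * proj (g m) = if l = m then proj (g l) else 0 := by
    intro l m
    rw [proj, proj, vecMulVec_mul_vecMulVec, hg]
    split_ifs with h
    · subst h; simp
    · simp
  have hQ : ∀ l, (proj (g l) ⊗ₖ (1 : Matrix iB iB ℂ))ᴴ = proj (g l) ⊗ₖ (1 : Matrix iB iB ℂ) := by
    intro l
    rw [conjTranspose_kronecker, hP, conjTranspose_one]
  have hQQ : ∀ l m, (proj (g l) ⊗ₖ (1 : Matrix iB iB ℂ)) * (proj (g m) ⊗ₖ (1 : Matrix iB iB ℂ)) =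
      if l = m then proj (g l) ⊗ₖ (1 : Matrix iB iB ℂ) else 0 := by
    intro l m
    rw [← Matrix.mul_kronecker_mul, hPP, Matrix.one_mul]
    split_ifs with h
    · rfl
    · simp
  have hQ1 : ∑ l, proj (g l) ⊗ₖ (1 : Matrix iB iB ℂ) = 1 := by
    rw [← Matrix.one_kronecker_one, ← hgc]
    ext x y
    simp [Matrix.sum_apply, Finset.sum_mul]
  have hred : redA2 (omega2 g σ) = ∑ l, proj (g l) * redA2 σ * proj (g l) := by
    simp only [← redA2_kron]
    ext i j
    simp only [omega2, redA2, Matrix.of_apply, Matrix.sum_apply]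
    rw [Finset.sum_comm]
  have hA := redA2_posSemidef hσ
  have hω : (omega2 g σ).PosSemidef := pinch_posSemidef hσ _ hQ
  have main := relent_mono σ (omega2 g σ) hσ hω (pinch_supp hσ _ hQ hQ1)
    (by rw [hred]; exact pinch_supp hA _ hP hgc)
  have t1 : trace (σ * mlog (omega2 g σ)) = trace (omega2 g σ * mlog (omega2 g σ)) :=
    pinch_trace hσ _ hQ hQQ hQ1
  have t2 : trace (redA2 σ * mlog (redA2 (omega2 g σ))) =
      trace (redA2 (omega2 g σ) * mlog (redA2 (omega2 g σ))) := by
    rw [hred]; exact pinch_trace hA _ hP hPP hgc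
  rw [t1, t2] at main
  simp only [vN]
  linarith
end
end
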